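/- Every permutation may be written as the inflation of a unique simple permutation; moreover if π = σ[α_1,...,α_m] with σ simple of length m ≥ 4, then the intervals α_1,...,α_m are uniquely determined. -/

import Mathlib

def Contig {n : ℕ} (s : Finset (Fin n)) : Prop := ∃ a b : Fin n, s = Finset.Icc a b

def IsPInterval {n : ℕ} (π : Equiv.Perm (Fin n)) (s : Finset (Fin n)) : Prop :=
  Contig s ∧ Contig (s.image π)

def IsSimplePerm {n : ℕ} (π : Equiv.Perm (Fin n)) : Prop :=
  ∀ s : Finset (Fin n), IsPInterval π s → s.card ≤ 1 ∨ s = Finset.univ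

/-- `π` is the inflation `σ[α 1, …, α m]`: each entry `σ i` is replaced by a block of
`ℓ i` contiguous positions and contiguous values order isomorphic to `α i`, the blocks
of values being ordered according to `σ`. -/
def IsInflation {N m : ℕ} (π : Equiv.Perm (Fin N)) (σ : Equiv.Perm (Fin m))
    (ℓ : Fin m → ℕ) (α : ∀ i, Equiv.Perm (Fin (ℓ i))) : Prop :=
  (∀ i, 0 < ℓ i) ∧ N = ∑ i, ℓ i ∧
  ∀ (i : Fin m) (t : Fin (ℓ i))
    (hp : (∑ j ∈ Finset.univ.filter (· < i), ℓ j) + (t : ℕ) < N),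
    (π ⟨(∑ j ∈ Finset.univ.filter (· < i), ℓ j) + (t : ℕ), hp⟩ : ℕ) =
      (∑ j ∈ Finset.univ.filter (fun j => σ j < σ i), ℓ j) + (α i t : ℕ)

/-- `f` is the block map of an inflation. -/
def BM {n m : ℕ} (π : Equiv.Perm (Fin n)) (σ : Equiv.Perm (Fin m)) (f : Fin n → Fin m) : Prop :=
  Monotone f ∧ Function.Surjective f ∧ ∀ x y, σ (f x) < σ (f y) → π x < π y

theorem bm_trans {n m k : ℕ} {π : Equiv.Perm (Fin n)} {σ : Equiv.Perm (Fin m)}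
    {τ : Equiv.Perm (Fin k)} {f : Fin n → Fin m} {g : Fin m → Fin k}
    (h₁ : BM π σ f) (h₂ : BM σ τ g) : BM π τ (g ∘ f) :=
  ⟨h₂.1.comp h₁.1, h₂.2.1.comp h₁.2.1, fun x y h => h₁.2.2 _ _ (h₂.2.2 _ _ h)⟩

theorem contig_of {n : ℕ} (s : Finset (Fin n)) (hs : s.Nonempty)
    (h : ∀ a ∈ s, ∀ b ∈ s, ∀ c, a < c → c < b → c ∈ s) : Contig s := by
  refine ⟨s.min' hs, s.max' hs, ?_⟩
  ext x
  rw [Finset.mem_Icc]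
  constructor
  · intro hx
    exact ⟨s.min'_le x hx, s.le_max' x hx⟩
  · rintro ⟨h1, h2⟩
    rcases h1.eq_or_lt with h1 | h1
    · rw [← h1]; exact s.min'_mem hs
    rcases h2.eq_or_lt with h2 | h2
    · rw [h2]; exact s.max'_mem hs
    exact h _ (s.min'_mem hs) _ (s.max'_mem hs) _ h1 h2

theorem between_pos {n m k : ℕ} {π : Equiv.Perm (Fin n)} {σ : Equiv.Perm (Fin m)}
    {τ : Equiv.Perm (Fin k)} {f : Fin n → Fin m} {g : Fin n → Fin k}
    (h₁ : BM π σ f) (h₂ : BM π τ g) {x y z : Fin n} (hxy : g x = g y)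
    (ha : f x < f z) (hb : f z < f y) : g z = g x := by
  have h1 := h₁.1.reflect_lt ha
  have h2 := h₁.1.reflect_lt hb
  have h3 := h₂.1 h1.le
  have h4 := h₂.1 h2.le
  rw [← hxy] at h4
  exact le_antisymm h4 h3

theorem between_val {n m k : ℕ} {π : Equiv.Perm (Fin n)} {σ : Equiv.Perm (Fin m)}
    {τ : Equiv.Perm (Fin k)} {f : Fin n → Fin m} {g : Fin n → Fin k}
    (h₁ : BM π σ f) (h₂ : BM π τ g) {x y z : Fin n} (hxy : g x = g y)
    (ha : σ (f x) < σ (f z)) (hb : σ (f z) < σ (f y)) : g z = g x := by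
  have h1 := h₁.2.2 _ _ ha
  have h2 := h₁.2.2 _ _ hb
  apply τ.injective
  apply le_antisymm
  · by_contra h
    push Not at h
    rw [hxy] at h
    exact absurd (h₂.2.2 _ _ h) h2.asymm
  · by_contra h
    push Not at h
    exact absurd (h₂.2.2 _ _ h) h1.asymm

theorem dichotomy {n m k : ℕ} {π : Equiv.Perm (Fin n)} {σ : Equiv.Perm (Fin m)}
    {τ : Equiv.Perm (Fin k)} {f : Fin n → Fin m} {g : Fin n → Fin k}
    (h₁ : BM π σ f) (h₂ : BM π τ g) (hs : IsSimplePerm σ) (j : Fin k) :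
    (∀ x y, g x = j → g y = j → f x = f y) ∨ (∀ i, ∃ x, g x = j ∧ f x = i) := by
  classical
  set B : Finset (Fin m) := (Finset.univ.filter (fun x => g x = j)).image f with hB
  have memB : ∀ i, i ∈ B ↔ ∃ x, g x = j ∧ f x = i := by intro i; simp [hB]
  have hne : B.Nonempty := by
    obtain ⟨x, hx⟩ := h₂.2.1 j
    exact ⟨f x, (memB _).2 ⟨x, hx, rfl⟩⟩
  have hint : IsPInterval σ B := by
    constructor
    · apply contig_of _ hne
      intro a ha b hb c hac hcb
      rw [memB] at *
      obtain ⟨x, hx, rfl⟩ := ha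
      obtain ⟨y, hy, rfl⟩ := hb
      obtain ⟨z, rfl⟩ := h₁.2.1 c
      exact ⟨z, (between_pos h₁ h₂ (hx.trans hy.symm) hac hcb).trans hx, rfl⟩
    · apply contig_of _ (hne.image _)
      intro a ha b hb c hac hcb
      rw [Finset.mem_image] at *
      obtain ⟨a, ha, rfl⟩ := ha
      obtain ⟨b, hb, rfl⟩ := hb
      rw [memB] at ha hb
      obtain ⟨x, hx, rfl⟩ := ha
      obtain ⟨y, hy, rfl⟩ := hb
      obtain ⟨c, rfl⟩ := σ.surjective c
      obtain ⟨z, rfl⟩ := h₁.2.1 c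
      exact ⟨f z, (memB _).2 ⟨z, (between_val h₁ h₂ (hx.trans hy.symm) hac hcb).trans hx, rfl⟩, rfl⟩
  rcases hs B hint with h | h
  · left
    intro x y hx hy
    rw [Finset.card_le_one] at h
    exact h _ ((memB _).2 ⟨x, hx, rfl⟩) _ ((memB _).2 ⟨y, hy, rfl⟩)
  · right
    intro i
    rw [← memB, h]
    exact Finset.mem_univ _

theorem bm_id {n : ℕ} (π : Equiv.Perm (Fin n)) : BM π π id :=
  ⟨monotone_id, Function.surjective_id, fun _ _ h => h⟩

theorem fin_mono_bij {m k : ℕ} (g : Fin m → Fin k) (hm : Monotone g)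
    (hb : Function.Bijective g) : ∃ h : m = k, ∀ i, g i = Fin.cast h i := by
  have h : m = k := by simpa using Fintype.card_of_bijective hb
  subst h
  refine ⟨rfl, fun i => ?_⟩
  let e : Fin m ≃o Fin m := StrictMono.orderIsoOfSurjective g (hm.strictMono_of_injective hb.1) hb.2
  have : e = OrderIso.refl _ := Subsingleton.elim _ _
  have h2 : e i = i := by rw [this]; rfl
  exact h2

theorem uniq_factor {n m k : ℕ} {π : Equiv.Perm (Fin n)} {σ : Equiv.Perm (Fin m)}
    {τ : Equiv.Perm (Fin k)} {f : Fin n → Fin m} {g : Fin n → Fin k}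
    (h₁ : BM π σ f) (h₂ : BM π τ g) (ht : IsSimplePerm τ) (hm : 2 ≤ m)
    (hfac : ∀ x y, g x = g y → f x = f y) :
    ∃ h : k = m, (∀ x, f x = Fin.cast h (g x)) ∧ ∀ j, (τ j : ℕ) = σ (Fin.cast h j) := by
  choose r hr using h₂.2.1
  have hq : ∀ x, f (r (g x)) = f x := fun x => hfac _ _ (hr _)
  have hQ : BM τ σ (fun j => f (r j)) := by
    refine ⟨?_, ?_, ?_⟩
    · intro a b hab
      rcases hab.eq_or_lt with rfl | hab
      · exact le_rfl
      apply h₁.1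
      apply (h₂.1.reflect_lt _).le
      rw [hr, hr]; exact hab
    · intro i
      obtain ⟨x, rfl⟩ := h₁.2.1 i
      exact ⟨g x, hq x⟩
    · intro a b hab
      have := h₁.2.2 _ _ hab
      by_contra hc
      push Not at hc
      rcases hc.eq_or_lt with hc | hc
      · have := τ.injective hc
        subst this
        exact lt_irrefl _ hab
      · rw [← hr a, ← hr b] at hc
        exact absurd (h₂.2.2 _ _ hc) this.asymm
  have hinj : Function.Injective (fun j => f (r j)) := by
    intro a b hab
    rcases dichotomy (bm_id τ) hQ ht (f (r a)) with h | h
    · exact h a b rfl hab.symm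
    · exfalso
      have hc : ∀ i : Fin m, i = f (r a) := by
        intro i
        obtain ⟨j, rfl⟩ := hQ.2.1 i
        obtain ⟨x, hx, hx'⟩ := h j
        simp only [id] at hx'
        subst hx'
        exact hx
      have := (hc ⟨0, by omega⟩).trans (hc ⟨1, by omega⟩).symm
      simp at this
  obtain ⟨h, hh⟩ := fin_mono_bij _ hQ.1 ⟨hinj, hQ.2.1⟩
  refine ⟨h, fun x => by rw [← hh, hq], ?_⟩
  subst h
  have hst : Monotone (fun v => τ (σ.symm v)) := by
    intro a b hab
    rcases hab.eq_or_lt with rfl | hab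
    · exact le_rfl
    apply le_of_lt
    apply hQ.2.2
    show σ (f (r _)) < σ (f (r _))
    rw [hh, hh]
    simpa using hab
  obtain ⟨_, h3⟩ := fin_mono_bij _ hst (τ.bijective.comp σ.symm.bijective)
  intro j
  have := h3 (σ j)
  simp only [Equiv.symm_apply_apply] at this
  rw [this]; rfl

theorem two_of_cross {n m k : ℕ} {π : Equiv.Perm (Fin n)} {σ : Equiv.Perm (Fin m)}
    {τ : Equiv.Perm (Fin k)} {f : Fin n → Fin m} {g : Fin n → Fin k}
    (h₁ : BM π σ f) (h₂ : BM π τ g) (hs : IsSimplePerm σ) (hm : 2 ≤ m) (hk : 2 ≤ k)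
    (i₀ : Fin m) (j₀ : Fin k) (hi : ∀ j, ∃ x, f x = i₀ ∧ g x = j)
    (hj : ∀ i, ∃ x, g x = j₀ ∧ f x = i) : m = 2 := by
  have hz : ∃ z, f z = i₀ ∧ g z ≠ j₀ := by
    have : Nontrivial (Fin k) := Fin.nontrivial_iff_two_le.2 hk
    obtain ⟨j, hjj⟩ := exists_ne j₀
    obtain ⟨z, hz, hz'⟩ := hi j
    exact ⟨z, hz, by rw [hz']; exact hjj⟩
  obtain ⟨z, rfl, hz⟩ := hz
  have hpos : ∀ a b, a < f z → f z < b → False := by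
    intro a b ha hb
    obtain ⟨x, hx, rfl⟩ := hj a
    obtain ⟨y, hy, rfl⟩ := hj b
    exact hz ((between_pos h₁ h₂ (hx.trans hy.symm) ha hb).trans hx)
  have hval : ∀ a b, σ a < σ (f z) → σ (f z) < σ b → False := by
    intro a b ha hb
    obtain ⟨x, hx, rfl⟩ := hj a
    obtain ⟨y, hy, rfl⟩ := hj b
    exact hz ((between_val h₁ h₂ (hx.trans hy.symm) ha hb).trans hx)
  classical
  have hne : ((Finset.univ : Finset (Fin m)).erase (f z)).Nonempty := by
    have : Nontrivial (Fin m) := Fin.nontrivial_iff_two_le.2 hm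
    obtain ⟨j, hjj⟩ := exists_ne (f z)
    exact ⟨j, by simp [hjj]⟩
  have hint : IsPInterval σ (Finset.univ.erase (f z)) := by
    constructor
    · apply contig_of _ hne
      intro a ha b hb c hac hcb
      simp only [Finset.mem_erase, Finset.mem_univ, and_true]
      rintro rfl
      exact hpos a b hac hcb
    · apply contig_of _ (hne.image _)
      intro a ha b hb c hac hcb
      obtain ⟨a, rfl⟩ := σ.surjective a
      obtain ⟨b, rfl⟩ := σ.surjective b
      obtain ⟨c, rfl⟩ := σ.surjective c
      rw [Finset.mem_image]
      refine ⟨c, ?_, rfl⟩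
      simp only [Finset.mem_erase, Finset.mem_univ, and_true]
      rintro rfl
      exact hval a b hac hcb
  rcases hs _ hint with h | h
  · rw [Finset.card_erase_of_mem (Finset.mem_univ _)] at h
    simp at h
    omega
  · have := Finset.mem_univ (f z)
    rw [← h] at this
    simp at this

theorem perm_two : ∀ σ τ : Equiv.Perm (Fin 2), (σ 0 < σ 1 ↔ τ 0 < τ 1) → σ = τ := by decide

theorem bm_two {n : ℕ} {π : Equiv.Perm (Fin n)} {σ : Equiv.Perm (Fin 2)} {f : Fin n → Fin 2}
    (h : BM π σ f) (a b : Fin n) (ha : ∀ x, a ≤ x) (hb : ∀ x, x ≤ b) :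
    σ 0 < σ 1 ↔ π a < π b := by
  have h0 : f a = 0 := by
    obtain ⟨x, hx⟩ := h.2.1 0
    have := h.1 (ha x)
    rw [hx] at this
    exact le_antisymm this (Fin.zero_le _)
  have h1 : f b = 1 := by
    obtain ⟨x, hx⟩ := h.2.1 1
    have := h.1 (hb x)
    rw [hx] at this
    omega
  constructor
  · intro hh
    apply h.2.2
    rwa [h0, h1]
  · intro hh
    by_contra hc
    push Not at hc
    have hc' : σ 1 < σ 0 := lt_of_le_of_ne hc (by simp)
    rw [← h0, ← h1] at hc'
    exact absurd (h.2.2 _ _ hc') hh.asymm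

theorem uniq_bm {n m k : ℕ} {π : Equiv.Perm (Fin n)} {σ : Equiv.Perm (Fin m)}
    {τ : Equiv.Perm (Fin k)} {f : Fin n → Fin m} {g : Fin n → Fin k} (hn : 2 ≤ n)
    (h₁ : BM π σ f) (h₂ : BM π τ g) (hs : IsSimplePerm σ) (ht : IsSimplePerm τ)
    (hm : 2 ≤ m) (hk : 2 ≤ k) :
    ∃ h : m = k, (∀ i, (σ i : ℕ) = τ (Fin.cast h i)) ∧
      (4 ≤ m → ∀ x, g x = Fin.cast h (f x)) := by
  by_cases hA : ∀ x y, g x = g y → f x = f y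
  · obtain ⟨h, h3, h4⟩ := uniq_factor h₁ h₂ ht hm hA
    subst h
    exact ⟨rfl, fun i => (h4 i).symm, fun _ x => (h3 x).symm⟩
  by_cases hB : ∀ x y, f x = f y → g x = g y
  · obtain ⟨h, h3, h4⟩ := uniq_factor h₂ h₁ hs hk hB
    exact ⟨h, h4, fun _ => h3⟩
  push Not at hA hB
  obtain ⟨x, y, hxy, hxy'⟩ := hA
  obtain ⟨u, v, huv, huv'⟩ := hB
  have hj := (dichotomy h₁ h₂ hs (g x)).resolve_left (fun h => hxy' (h x y rfl hxy.symm))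
  have hi := (dichotomy h₂ h₁ ht (f u)).resolve_left (fun h => huv' (h u v rfl huv.symm))
  have e1 := two_of_cross h₁ h₂ hs hm hk _ _ hi hj
  have e2 := two_of_cross h₂ h₁ ht hk hm _ _ hj hi
  subst e1 e2
  refine ⟨rfl, ?_, fun h => by omega⟩
  have : σ = τ := by
    apply perm_two
    have ha : ∀ x : Fin n, (⟨0, by omega⟩ : Fin n) ≤ x := fun x => by
      rw [Fin.le_def]; simp
    have hb : ∀ x : Fin n, x ≤ (⟨n - 1, by omega⟩ : Fin n) := fun x => by
      rw [Fin.le_def]; simp; omega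
    rw [bm_two h₁ _ _ ha hb, bm_two h₂ _ _ ha hb]
  subst this
  intro i; rfl

theorem S_le {m : ℕ} (ℓ : Fin m → ℕ) (p : Fin m → Fin m) {i i' : Fin m} (h : p i < p i') :
    (∑ j ∈ Finset.univ.filter (fun j => p j < p i), ℓ j) + ℓ i ≤
      ∑ j ∈ Finset.univ.filter (fun j => p j < p i'), ℓ j := by
  classical
  rw [add_comm, ← Finset.sum_insert (s := Finset.univ.filter (fun j => p j < p i)) (a := i) (by simp)]
  apply Finset.sum_le_sum_of_subset
  intro j hj
  simp only [Finset.mem_insert, Finset.mem_filter, Finset.mem_univ, true_and] at *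
  rcases hj with rfl | hj
  · exact h
  · exact hj.trans h

theorem sum_castLE {m : ℕ} (ℓ : Fin m → ℕ) (i : Fin m) :
    ∑ j : Fin (i : ℕ), ℓ (Fin.castLE i.2.le j) = ∑ j ∈ Finset.univ.filter (· < i), ℓ j := by
  apply Finset.sum_bij (fun j _ => Fin.castLE i.2.le j)
  · intro a _
    rw [Finset.mem_filter, Fin.lt_def]
    exact ⟨Finset.mem_univ _, a.2⟩
  · intro a _ b _ h
    simpa using h
  · intro b hb
    simp only [Finset.mem_filter, Finset.mem_univ, true_and] at hb
    exact ⟨⟨b, hb⟩, Finset.mem_univ _, rfl⟩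
  · intros; rfl

theorem bm_of_inflation {n m : ℕ} {π : Equiv.Perm (Fin n)} {σ : Equiv.Perm (Fin m)}
    {ℓ : Fin m → ℕ} {α : ∀ i, Equiv.Perm (Fin (ℓ i))} (h : IsInflation π σ ℓ α) :
    ∃ f : Fin n → Fin m, BM π σ f ∧ ∀ i, ℓ i = Fintype.card {x // f x = i} := by
  obtain ⟨hpos, hN, hval⟩ := h
  subst hN
  set e := finSigmaFinEquiv (n := ℓ) with he
  have hx : ∀ x : Fin (∑ i, ℓ i), (x : ℕ) = (∑ j ∈ Finset.univ.filter (· < (e.symm x).1), ℓ j) + ((e.symm x).2 : ℕ) := by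
    intro x
    rw [← sum_castLE, ← finSigmaFinEquiv_apply, ← he, Equiv.apply_symm_apply]
  have hv : ∀ x, (π x : ℕ) = (∑ j ∈ Finset.univ.filter (fun j => σ j < σ (e.symm x).1), ℓ j)
      + (α _ (e.symm x).2 : ℕ) := by
    intro x
    rw [← hval _ _ (by rw [← hx]; exact x.2)]
    congr 2
    exact Fin.ext (hx x)
  refine ⟨fun x => (e.symm x).1, ⟨?_, ?_, ?_⟩, ?_⟩
  · intro x y hxy
    by_contra hc
    push Not at hc
    have h1 := S_le ℓ id hc
    simp only [id] at h1
    have h2 := hx x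
    have h3 := hx y
    have h4 := (e.symm y).2.2
    rw [Fin.le_def] at hxy
    omega
  · intro i
    exact ⟨e ⟨i, ⟨0, hpos i⟩⟩, by simp⟩
  · intro x y hxy
    have h1 := S_le ℓ σ hxy
    simp only [] at h1
    have h2 := hv x
    have h3 := hv y
    have h4 := (α _ (e.symm x).2).2
    rw [Fin.lt_def]
    omega
  · intro i
    rw [← Fintype.card_fin (ℓ i)]
    apply Fintype.card_congr
    exact (Equiv.sigmaSubtype i).symm.trans (e.subtypeEquiv (fun p => by simp))

theorem card_fib {n m : ℕ} (f : Fin n → Fin m) (P : Fin m → Prop) [DecidablePred P] :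
    ∑ j ∈ Finset.univ.filter P, (Finset.univ.filter (fun x => f x = j)).card =
      (Finset.univ.filter (fun x => P (f x))).card := by
  rw [Finset.card_eq_sum_card_fiberwise (f := f) (t := Finset.univ.filter P)]
  · apply Finset.sum_congr rfl
    intro j hj
    congr 1
    ext x
    simp only [Finset.mem_filter, Finset.mem_univ, true_and] at *
    constructor
    · rintro rfl; exact ⟨hj, rfl⟩
    · exact fun h => h.2
  · intro x hx
    simpa using hx

theorem inflation_of_bm {n m : ℕ} {π : Equiv.Perm (Fin n)} {σ : Equiv.Perm (Fin m)}
    {f : Fin n → Fin m} (h : BM π σ f) :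
    ∃ (ℓ : Fin m → ℕ) (α : ∀ i, Equiv.Perm (Fin (ℓ i))), IsInflation π σ ℓ α := by
  classical
  set ℓ : Fin m → ℕ := fun i => (Finset.univ.filter (fun x => f x = i)).card with hℓ
  have hsum : n = ∑ i, ℓ i := by
    have := card_fib f (fun _ => True)
    simp at this
    exact this.symm
  have hle : ∀ (p : Fin m → Fin m), Function.Injective p → ∀ i,
      (Finset.univ.filter (fun x => p (f x) ≤ p i)).card =
      (∑ j ∈ Finset.univ.filter (fun j => p j < p i), ℓ j) + ℓ i := by
    intro p hp i
    rw [hℓ, card_fib f (fun j => p j < p i)]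
    rw [← Finset.card_union_of_disjoint]
    · congr 1
      ext x
      simp [le_iff_lt_or_eq, hp.eq_iff]
    · rw [Finset.disjoint_filter]
      rintro x _ hx rfl
      exact lt_irrefl _ hx
  have hlt : ∀ (p : Fin m → Fin m) i,
      (∑ j ∈ Finset.univ.filter (fun j => p j < p i), ℓ j) =
      (Finset.univ.filter (fun x => p (f x) < p i)).card := by
    intro p i
    rw [hℓ, card_fib f (fun j => p j < p i)]
  have hfib : ∀ (i : Fin m) (t : ℕ), t < ℓ i →
      ∀ hp : (∑ j ∈ Finset.univ.filter (· < i), ℓ j) + t < n, f ⟨_, hp⟩ = i := by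
    intro i t ht hp
    have h1 := hlt id i
    have h2 := hle id Function.injective_id i
    simp only [id] at h1 h2
    generalize hS : (∑ j ∈ Finset.univ.filter (· < i), ℓ j) = S at *
    apply le_antisymm
    · by_contra hc
      push Not at hc
      have : (Finset.univ.filter (fun x => f x ≤ i)) ⊆ Finset.Iio (⟨S + t, hp⟩ : Fin n) := by
        intro x hx
        simp only [Finset.mem_filter, Finset.mem_univ, true_and] at hx
        rw [Finset.mem_Iio]
        exact h.1.reflect_lt (hx.trans_lt hc)
      have h3 := Finset.card_le_card this
      rw [Fin.card_Iio] at h3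
      simp only at h3
      omega
    · by_contra hc
      push Not at hc
      have : Finset.Iic (⟨S + t, hp⟩ : Fin n) ⊆ (Finset.univ.filter (fun x => f x < i)) := by
        intro x hx
        simp only [Finset.mem_filter, Finset.mem_univ, true_and]
        rw [Finset.mem_Iic] at hx
        exact (h.1 hx).trans_lt hc
      have h3 := Finset.card_le_card this
      rw [Fin.card_Iic] at h3
      simp only at h3
      omega
  have hvlo : ∀ x, (∑ j ∈ Finset.univ.filter (fun j => σ j < σ (f x)), ℓ j) ≤ (π x : ℕ) := by
    intro x
    rw [hlt σ, ← Fin.card_Iio, ← Finset.card_image_of_injective _ π.injective]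
    apply Finset.card_le_card
    intro v hv
    simp only [Finset.mem_image, Finset.mem_filter, Finset.mem_univ, true_and] at hv
    obtain ⟨y, hy, rfl⟩ := hv
    rw [Finset.mem_Iio]
    exact h.2.2 _ _ hy
  have hvhi : ∀ x, (π x : ℕ) <
      (∑ j ∈ Finset.univ.filter (fun j => σ j < σ (f x)), ℓ j) + ℓ (f x) := by
    intro x
    rw [← hle σ σ.injective, ← Nat.succ_le_iff, Nat.succ_eq_add_one, ← Fin.card_Iic,
      ← Finset.card_image_of_injective (Finset.univ.filter _) π.injective]
    apply Finset.card_le_card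
    intro v hv
    obtain ⟨y, rfl⟩ := π.surjective v
    rw [Finset.mem_Iic] at hv
    rw [Finset.mem_image]
    refine ⟨y, ?_, rfl⟩
    simp only [Finset.mem_filter, Finset.mem_univ, true_and]
    by_contra hc
    push Not at hc
    exact absurd (h.2.2 _ _ hc) hv.not_gt
  have hlt' : ∀ i (t : Fin (ℓ i)), (∑ j ∈ Finset.univ.filter (· < i), ℓ j) + (t : ℕ) < n := by
    intro i t
    have h2 := hle id Function.injective_id i
    simp only [id] at h2
    have h3 := Finset.card_le_univ (Finset.univ.filter (fun x => f x ≤ i))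
    rw [Fintype.card_fin] at h3
    have := t.2
    omega
  let F : ∀ i, Fin (ℓ i) → Fin (ℓ i) := fun i t =>
    ⟨(π ⟨_, hlt' i t⟩ : ℕ) - (∑ j ∈ Finset.univ.filter (fun j => σ j < σ i), ℓ j), by
      have h1 := hvhi ⟨_, hlt' i t⟩
      have h2 := hvlo ⟨_, hlt' i t⟩
      rw [hfib i t t.2] at h1 h2
      omega⟩
  have hF : ∀ i (t : Fin (ℓ i)), (π ⟨_, hlt' i t⟩ : ℕ) =
      (∑ j ∈ Finset.univ.filter (fun j => σ j < σ i), ℓ j) + (F i t : ℕ) := by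
    intro i t
    have h2 := hvlo ⟨_, hlt' i t⟩
    rw [hfib i t t.2] at h2
    simp only [F]
    omega
  have hFi : ∀ i, Function.Injective (F i) := by
    intro i a b hab
    have h1 := hF i a
    rw [hab, ← hF i b] at h1
    have h2 := π.injective (Fin.ext h1)
    simpa [Fin.ext_iff] using h2
  refine ⟨ℓ, fun i => Equiv.ofBijective (F i) (Finite.injective_iff_bijective.1 (hFi i)), ?_, hsum, ?_⟩
  · intro i
    obtain ⟨x, hx⟩ := h.2.1 i
    exact Finset.card_pos.2 ⟨x, by simp [hx]⟩
  · intro i t hp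
    exact hF i t

theorem contract {n : ℕ} (π : Equiv.Perm (Fin n)) (hs : ¬ IsSimplePerm π) :
    ∃ m, m < n ∧ 2 ≤ m ∧ ∃ (σ : Equiv.Perm (Fin m)) (f : Fin n → Fin m), BM π σ f := by
  classical
  unfold IsSimplePerm at hs
  push Not at hs
  obtain ⟨s, ⟨⟨a, b, hab⟩, c, d, hcd⟩, h1, h2⟩ := hs
  have hcard : s.card < n := by
    have := (Finset.card_lt_iff_ne_univ s).2 h2
    simpa using this
  have hcs : s.card = b + 1 - a := by rw [hab, Fin.card_Icc]
  have hcs' : s.card = d + 1 - c := by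
    rw [← Fin.card_Icc, ← hcd, Finset.card_image_of_injective _ π.injective]
  have hmem : ∀ x, (c ≤ π x ∧ π x ≤ d) ↔ (a ≤ x ∧ x ≤ b) := by
    intro x
    rw [← Finset.mem_Icc, ← Finset.mem_Icc, ← hab, ← hcd]
    simp
  simp only [Fin.le_def] at hmem
  obtain ⟨k, hk⟩ : ∃ k, s.card = k + 1 := ⟨s.card - 1, by omega⟩
  have hb := b.2
  have hd := d.2
  let G : Fin n → Fin n → Fin (n - k) := fun a x =>
    ⟨min (if (x : ℕ) ≤ a then (x : ℕ) else if (x : ℕ) ≤ a + k then a else x - k) (n - k - 1), by omega⟩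
  have hG : ∀ a' : Fin n, (a' : ℕ) + k < n → ∀ x, (G a' x : ℕ) =
      if (x : ℕ) ≤ a' then (x : ℕ) else if (x : ℕ) ≤ a' + k then a' else x - k := by
    intro a' ha' x
    simp only [G]
    split_ifs <;> omega
  have hGa := hG a (by omega)
  have hGc := hG c (by omega)
  let R : Fin (n - k) → Fin n := fun y => ⟨if (y : ℕ) ≤ a then y else y + k, by split_ifs <;> omega⟩
  have hR : ∀ y, (R y : ℕ) = if (y : ℕ) ≤ a then (y : ℕ) else y + k := fun y => rfl
  have hmono : ∀ x y : Fin n, x ≤ y → (G c x : ℕ) ≤ G c y := by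
    intro x y hxy
    rw [Fin.le_def] at hxy
    rw [hGc, hGc]
    split_ifs <;> omega
  have hinj : Function.Injective (fun y => G c (π (R y))) := by
    intro y y' hyy
    have e := congrArg Fin.val hyy
    simp only [hGc] at e
    have m1 := hmem (R y)
    have m2 := hmem (R y')
    have e1 := hR y
    have e2 := hR y'
    have key : (π (R y) : ℕ) = π (R y') ∨ ((c ≤ (π (R y) : ℕ) ∧ (π (R y) : ℕ) ≤ d) ∧
      (c ≤ (π (R y') : ℕ) ∧ (π (R y') : ℕ) ≤ d)) := by
      split_ifs at e <;> omega
    rcases key with key | ⟨k1, k2⟩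
    · have := congrArg Fin.val (π.injective (Fin.ext key))
      apply Fin.ext
      rw [e1, e2] at this
      split_ifs at this <;> omega
    · have k1 := m1.1 k1
      have k2 := m2.1 k2
      apply Fin.ext
      rw [e1] at k1
      rw [e2] at k2
      split_ifs at k1 k2 <;> omega
  refine ⟨n - k, by omega, by omega,
    Equiv.ofBijective _ (Finite.injective_iff_bijective.1 hinj), G a, ?_, ?_, ?_⟩
  · intro x y hxy
    rw [Fin.le_def] at *
    rw [hGa, hGa]
    split_ifs <;> omega
  · intro y
    refine ⟨R y, Fin.ext ?_⟩
    rw [hGa, hR]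
    split_ifs <;> omega
  · have hrep : ∀ x, (G c (π (R (G a x))) : ℕ) = G c (π x) := by
      intro x
      have e1 := hR (G a x)
      rw [hGa] at e1
      by_cases hx : (a : ℕ) ≤ x ∧ (x : ℕ) ≤ b
      · have hx' : (a : ℕ) ≤ R (G a x) ∧ (R (G a x) : ℕ) ≤ b := by
          split_ifs at e1 <;> omega
        have m1 := (hmem _).2 hx
        have m2 := (hmem _).2 hx'
        rw [hGc, hGc]
        split_ifs <;> omega
      · have : R (G a x) = x := by
          apply Fin.ext
          split_ifs at e1 <;> omega
        rw [this]
    intro x y hxy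
    simp only [Equiv.ofBijective_apply, Fin.lt_def] at hxy
    rw [hrep, hrep] at hxy
    by_contra hc
    push Not at hc
    have := hmono _ _ hc
    omega

theorem exists_bm : ∀ (n : ℕ), 2 ≤ n → ∀ π : Equiv.Perm (Fin n),
    ∃ (m : ℕ) (σ : Equiv.Perm (Fin m)) (f : Fin n → Fin m), 2 ≤ m ∧ IsSimplePerm σ ∧ BM π σ f := by
  intro n
  induction n using Nat.strong_induction_on with
  | _ n ih =>
    intro hn π
    by_cases hs : IsSimplePerm π
    · exact ⟨n, π, id, hn, hs, bm_id π⟩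
    · obtain ⟨m, hm, hm2, σ, f, hf⟩ := contract π hs
      obtain ⟨k, τ, g, hk, ht, hg⟩ := ih m hm hm2 σ
      exact ⟨k, τ, g ∘ f, hk, ht, bm_trans hf hg⟩

/-- Substitution decomposition (Albert–Atkinson): every permutation of length `n ≥ 2` is
the inflation of a unique simple permutation of length `m ≥ 2`; moreover when `m ≥ 4`
the blocks are unique as well. -/
theorem stmt14 (n : ℕ) (hn : 2 ≤ n) (π : Equiv.Perm (Fin n)) :
    (∃ (m : ℕ) (σ : Equiv.Perm (Fin m)) (ℓ : Fin m → ℕ) (α : ∀ i, Equiv.Perm (Fin (ℓ i))),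
      2 ≤ m ∧ IsSimplePerm σ ∧ IsInflation π σ ℓ α) ∧
    (∀ (m₁ m₂ : ℕ) (σ₁ : Equiv.Perm (Fin m₁)) (σ₂ : Equiv.Perm (Fin m₂))
      (ℓ₁ : Fin m₁ → ℕ) (ℓ₂ : Fin m₂ → ℕ)
      (α₁ : ∀ i, Equiv.Perm (Fin (ℓ₁ i))) (α₂ : ∀ i, Equiv.Perm (Fin (ℓ₂ i))),
      2 ≤ m₁ → 2 ≤ m₂ → IsSimplePerm σ₁ → IsSimplePerm σ₂ →
      IsInflation π σ₁ ℓ₁ α₁ → IsInflation π σ₂ ℓ₂ α₂ →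
      ∃ h : m₁ = m₂,
        (∀ i : Fin m₁, (σ₁ i : ℕ) = (σ₂ (Fin.cast h i) : ℕ)) ∧
        (4 ≤ m₁ → ∀ i : Fin m₁, ℓ₁ i = ℓ₂ (Fin.cast h i) ∧
          ∀ (t : Fin (ℓ₁ i)) (ht : (t : ℕ) < ℓ₂ (Fin.cast h i)),
            (α₁ i t : ℕ) = (α₂ (Fin.cast h i) ⟨t, ht⟩ : ℕ))) := by
  constructor
  · obtain ⟨m, σ, f, hm, hs, hf⟩ := exists_bm n hn π
    obtain ⟨ℓ, α, h⟩ := inflation_of_bm hf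
    exact ⟨m, σ, ℓ, α, hm, hs, h⟩
  · intro m₁ m₂ σ₁ σ₂ ℓ₁ ℓ₂ α₁ α₂ hm₁ hm₂ hs₁ hs₂ h₁ h₂
    obtain ⟨f, hf, hfl⟩ := bm_of_inflation h₁
    obtain ⟨g, hg, hgl⟩ := bm_of_inflation h₂
    obtain ⟨h, hσ, hfg⟩ := uniq_bm hn hf hg hs₁ hs₂ hm₁ hm₂
    refine ⟨h, hσ, ?_⟩
    subst h
    intro h4
    have hσ' : σ₁ = σ₂ := Equiv.ext fun i => Fin.ext (hσ i)
    subst hσ'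
    have hfg' : g = f := funext (hfg h4)
    subst hfg'
    have hl : ℓ₁ = ℓ₂ := funext fun i => (hfl i).trans (hgl i).symm
    subst hl
    intro i
    refine ⟨rfl, fun t ht => ?_⟩
    have hp : (∑ j ∈ Finset.univ.filter (· < i), ℓ₁ j) + (t : ℕ) < n := by
      have h5 := Finset.sum_le_sum_of_subset (f := ℓ₁)
        (Finset.subset_univ (insert i (Finset.univ.filter (· < i))))
      rw [Finset.sum_insert (by simp), ← h₁.2.1] at h5
      have := t.2
      omega
    have e1 := h₁.2.2 i t hp
    have e2 := h₂.2.2 i t hp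
    have e3 : (α₁ i t : ℕ) = (α₂ i t : ℕ) := by omega
    exact e3
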